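/- Let f̄ : [−1, 0] → ℝ be continuous with 0 < f̄(x) < 1/2 for all x ∈ [−1, 0], and let b = √(1 − 2 f̄(−1)). Let T(x) be the solution on (−1, 0] of the Riccati equation (1 − x²) T' + T² = −2(1 − x²) + (1 − 2 f̄(x)) with T(−1) = b. Choosing constants 0 < c ≤ d < 1 with c² ≤ 1 − 2 f̄(x) ≤ d² on [−1, 0], the solution T exists on all of [−1, 0] and satisfies T_c(x) ≤ T(x) ≤ T_d(x) there, where T_e(x) = e − (1 − x²)/(e − x); in particular T(0) ≤ d − 1/d < 0. -/

import Mathlib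

open Set Filter Topology MeasureTheory

noncomputable section

def rF (q T : ℝ → ℝ) (y : ℝ) : ℝ :=
  (2 * T y - T y ^ 2 + q y) / (1 - y) ^ 2 - 2 * (1 + y) / (1 - y)

def rPhi (q T : ℝ → ℝ) (x : ℝ) : ℝ := (1 - x) / (1 + x) * ∫ y in (-1 : ℝ)..x, rF q T y

def rE (e x : ℝ) : ℝ := e - (1 - x ^ 2) / (e - x)

def rSeq (q : ℝ → ℝ) (c : ℝ) : ℕ → ℝ → ℝ
  | 0 => rE c
  | n + 1 => rPhi q (rSeq q c n)

abbrev rJ : Set ℝ := Ioc (-1 : ℝ) 0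

lemma rF_bound {q T : ℝ → ℝ} {M : ℝ} {y : ℝ} (hy : y ∈ rJ) (hT : |T y| ≤ M) (hq : |q y| ≤ 1) :
    ‖rF q T y‖ ≤ 2 * M + M ^ 2 + 3 := by
  obtain ⟨h1, h2⟩ := hy
  have hM : 0 ≤ M := (abs_nonneg _).trans hT
  have a1 : |2 * T y - T y ^ 2 + q y| ≤ 2 * M + M ^ 2 + 1 := by
    have : |T y| ^ 2 ≤ M ^ 2 := by gcongr
    rw [sq_abs] at this
    have h3 := abs_le.1 hT
    have h4 := abs_le.1 hq
    rw [abs_le]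
    constructor <;> nlinarith [sq_nonneg (T y)]
  have a2 : |(2 * T y - T y ^ 2 + q y) / (1 - y) ^ 2| ≤ 2 * M + M ^ 2 + 1 := by
    rw [abs_div, abs_of_pos (by nlinarith : (0:ℝ) < (1 - y) ^ 2)]
    refine (div_le_self (abs_nonneg _) (by nlinarith)).trans a1
  have a3 : |2 * (1 + y) / (1 - y)| ≤ 2 := by
    rw [abs_of_nonneg (div_nonneg (by linarith) (by linarith)), div_le_iff₀ (by linarith)]
    linarith
  unfold rF
  rw [Real.norm_eq_abs]
  refine (abs_sub _ _).trans ?_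
  linarith

lemma rF_meas {q T : ℝ → ℝ} (hq : AEStronglyMeasurable q (volume.restrict rJ))
    (hT : AEStronglyMeasurable T (volume.restrict rJ)) :
    AEStronglyMeasurable (rF q T) (volume.restrict rJ) := by
  have hq' := hq.aemeasurable
  have hT' := hT.aemeasurable
  refine AEMeasurable.aestronglyMeasurable ?_
  unfold rF
  fun_prop

lemma rF_int {q T : ℝ → ℝ} {M : ℝ} (hq : AEStronglyMeasurable q (volume.restrict rJ))
    (hT : AEStronglyMeasurable T (volume.restrict rJ))
    (hTb : ∀ y ∈ rJ, |T y| ≤ M) (hqb : ∀ y ∈ rJ, |q y| ≤ 1) :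
    IntegrableOn (rF q T) rJ := by
  refine Integrable.of_bound (rF_meas hq hT) (2 * M + M ^ 2 + 3) ?_
  filter_upwards [ae_restrict_mem measurableSet_Ioc] with y hy
  exact rF_bound hy (hTb y hy) (hqb y hy)

lemma rInt_sub {g : ℝ → ℝ} (h : IntegrableOn g rJ) {x : ℝ} (hx : x ∈ rJ) :
    IntervalIntegrable g volume (-1) x := by
  rw [intervalIntegrable_iff_integrableOn_Ioc_of_le hx.1.le]
  exact h.mono_set (Ioc_subset_Ioc_right hx.2)

lemma rPhi_cont {q T : ℝ → ℝ} (h : IntegrableOn (rF q T) rJ) :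
    ContinuousOn (rPhi q T) rJ := by
  have h1 : ContinuousOn (fun x => ∫ y in (-1 : ℝ)..x, rF q T y) (Icc (-1) 0) := by
    have := intervalIntegral.continuousOn_primitive_interval (μ := volume) (f := rF q T) (a := -1) (b := 0)
      (by rw [uIcc_of_le (by norm_num), integrableOn_Icc_iff_integrableOn_Ioc]; exact h)
    rwa [uIcc_of_le (by norm_num)] at this
  unfold rPhi
  refine ContinuousOn.mul ?_ (h1.mono Ioc_subset_Icc_self)
  refine ContinuousOn.div (by fun_prop) (by fun_prop) ?_
  intro x hx
  have := hx.1
  linarith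

lemma rPhi_mono {q q' T S : ℝ → ℝ} (h : IntegrableOn (rF q T) rJ) (h' : IntegrableOn (rF q' S) rJ)
    (hTS : ∀ y ∈ rJ, T y ≤ S y) (hS : ∀ y ∈ rJ, S y ≤ 1) (hq : ∀ y ∈ rJ, q y ≤ q' y)
    {x : ℝ} (hx : x ∈ rJ) : rPhi q T x ≤ rPhi q' S x := by
  unfold rPhi
  obtain ⟨h1, h2⟩ := hx
  refine mul_le_mul_of_nonneg_left ?_ (div_nonneg (by linarith) (by linarith))
  refine intervalIntegral.integral_mono_on_of_le_Ioo h1.le (rInt_sub h ⟨h1, h2⟩) (rInt_sub h' ⟨h1, h2⟩) ?_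
  intro y hy
  have hy' : y ∈ rJ := ⟨hy.1, hy.2.le.trans h2⟩
  unfold rF
  have := hTS y hy'
  have := hS y hy'
  have := hq y hy'
  gcongr ?_ / _ - _
  nlinarith

lemma rE_hasDeriv {e y : ℝ} (he : 0 < e) (hy : y ≤ 0) :
    HasDerivAt (rE e) ((2 * y * (e - y) - (1 - y ^ 2)) / (e - y) ^ 2) y := by
  have hne : e - y ≠ 0 := by linarith
  have h := ((((hasDerivAt_id y).pow 2).const_sub 1).div ((hasDerivAt_id y).const_sub e) hne).const_sub e
  refine h.congr_deriv ?_
  simp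
  field_simp
  ring

lemma rE_cont {e : ℝ} (he : 0 < e) : ContinuousOn (rE e) (Icc (-1) 0) :=
  fun _ hy => (rE_hasDeriv he hy.2).continuousAt.continuousWithinAt

lemma rE_le {e y : ℝ} (he : 0 < e) (hy : y ∈ rJ) : rE e y ≤ e := by
  obtain ⟨h1, h2⟩ := hy
  unfold rE
  have : 0 ≤ (1 - y ^ 2) / (e - y) := div_nonneg (by nlinarith) (by linarith)
  linarith

lemma rE_ge {e y : ℝ} (he : 0 < e) (hy : y ∈ rJ) : -(1 / e) ≤ rE e y := by
  obtain ⟨h1, h2⟩ := hy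
  unfold rE
  have : (1 - y ^ 2) / (e - y) ≤ 1 / e := div_le_div₀ (by norm_num) (by nlinarith) he (by linarith)
  linarith

lemma rE_fix {e : ℝ} (he : 0 < e) (hi : IntegrableOn (rF (fun _ => e ^ 2) (rE e)) rJ)
    {x : ℝ} (hx : x ∈ rJ) :
    rPhi (fun _ => e ^ 2) (rE e) x = rE e x := by
  have key : ∫ y in (-1 : ℝ)..x, rF (fun _ => e ^ 2) (rE e) y
      = (1 + x) / (1 - x) * rE e x - (1 + (-1)) / (1 - (-1)) * rE e (-1) := by
    refine intervalIntegral.integral_eq_sub_of_hasDerivAt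
      (f := fun y => (1 + y) / (1 - y) * rE e y) ?_ (rInt_sub hi hx)
    intro y hy
    rw [uIcc_of_le hx.1.le] at hy
    have hy0 : y ≤ 0 := hy.2.trans hx.2
    have hne : 1 - y ≠ 0 := by linarith
    have hne' : e - y ≠ 0 := by linarith
    have h := ((((hasDerivAt_id y).const_add 1).div ((hasDerivAt_id y).const_sub 1) hne)).mul
      (rE_hasDeriv he hy0)
    refine h.congr_deriv ?_
    simp [rF, rE]
    field_simp
    ring
  unfold rPhi
  rw [key]
  have h1 : 1 - x ≠ 0 := by have := hx.2; linarith
  have h2 : 1 + x ≠ 0 := by have := hx.1; linarith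
  field_simp
  ring

lemma rE_mono {c d : ℝ} (hc : 0 < c) (hcd : c ≤ d) {y : ℝ} (hy : y ∈ rJ) : rE c y ≤ rE d y := by
  obtain ⟨h1, h2⟩ := hy
  unfold rE
  have : (1 - y ^ 2) / (d - y) ≤ (1 - y ^ 2) / (c - y) :=
    div_le_div_of_nonneg_left (by nlinarith) (by linarith) (by linarith)
  linarith

lemma rW_int {x : ℝ} (hx : x ∈ rJ) :
    IntervalIntegrable (fun y : ℝ => 1 / (1 - y) ^ 2) volume (-1) x ∧
    ∫ y in (-1 : ℝ)..x, 1 / (1 - y) ^ 2 = (1 + x) / (1 - x) / 2 := by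
  have hi : IntervalIntegrable (fun y : ℝ => 1 / (1 - y) ^ 2) volume (-1) x := by
    refine ContinuousOn.intervalIntegrable ?_
    rw [uIcc_of_le hx.1.le]
    refine ContinuousOn.div (by fun_prop) (by fun_prop) ?_
    intro y hy
    have h1 : 1 - y ≠ 0 := by have := hx.2; have := hy.2; linarith
    positivity
  refine ⟨hi, ?_⟩
  rw [intervalIntegral.integral_eq_sub_of_hasDerivAt (f := fun y => (1 + y) / (1 - y) / 2) ?_ hi]
  · norm_num
  intro y hy
  rw [uIcc_of_le hx.1.le] at hy
  have hne : 1 - y ≠ 0 := by have := hx.2; have := hy.2; linarith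
  have h := (((hasDerivAt_id y).const_add 1).div ((hasDerivAt_id y).const_sub 1) hne).div_const 2
  refine h.congr_deriv ?_
  simp
  field_simp
  ring

/-- Local estimate near the singular point. -/
lemma r_local {q T : ℝ → ℝ} {b ε L x0 : ℝ} (hb : 0 < b) (hb1 : b ≤ 1) 
    (hi : IntegrableOn (rF q T) rJ) (hx0 : x0 ∈ rJ)
    (hfix : ∀ x ∈ rJ, T x = rPhi q T x)
    (hT0 : ∀ y ∈ Ioc (-1) x0, 0 ≤ T y ∧ T y ≤ 1)
    (hq : ∀ y ∈ Ioc (-1) x0, |q y - b ^ 2| + 2 * (1 - y ^ 2) ≤ ε)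
    (hL : ∀ y ∈ Ioc (-1) x0, |T y - b| ≤ L) :
    ∀ x ∈ Ioc (-1) x0, |T x - b| ≤ (L * (2 - b) + ε) / 2 := by
  intro x hx
  have hxJ : x ∈ rJ := ⟨hx.1, hx.2.trans hx0.2⟩
  obtain ⟨hW, hWe⟩ := rW_int hxJ
  have p1 : 0 < 1 - x := by linarith [hxJ.2]
  have p2 : 0 < 1 + x := by linarith [hxJ.1]
  have e1 : T x - b = (1 - x) / (1 + x) *
      ∫ y in (-1 : ℝ)..x, (rF q T y - 2 * b * (1 / (1 - y) ^ 2)) := by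
    rw [intervalIntegral.integral_sub (rInt_sub hi hxJ) (hW.const_mul _),
      intervalIntegral.integral_const_mul, hWe, hfix x hxJ]
    unfold rPhi
    field_simp
  have e2 : ‖∫ y in (-1 : ℝ)..x, (rF q T y - 2 * b * (1 / (1 - y) ^ 2))‖ ≤
      ∫ y in (-1 : ℝ)..x, (L * (2 - b) + ε) * (1 / (1 - y) ^ 2) := by
    refine intervalIntegral.norm_integral_le_of_norm_le hx.1.le ?_ (hW.const_mul _)
    refine Eventually.of_forall ?_
    intro y hy
    have hy' : y ∈ Ioc (-1) x0 := ⟨hy.1, hy.2.trans hx.2⟩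
    have hy1 : 0 < 1 - y := by linarith [hy.2]
    have : rF q T y - 2 * b * (1 / (1 - y) ^ 2) =
      ((T y - b) * (2 - b - T y) + (q y - b ^ 2) - 2 * (1 - y ^ 2)) * (1 / (1 - y) ^ 2) := by
      unfold rF
      field_simp
      ring
    rw [this, Real.norm_eq_abs, abs_mul, abs_of_nonneg (by positivity : 0 ≤ 1 / (1 - y) ^ 2)]
    refine mul_le_mul_of_nonneg_right ?_ (by positivity)
    obtain ⟨t0, t1⟩ := hT0 y hy'
    have b1 : |(T y - b) * (2 - b - T y)| ≤ L * (2 - b) := by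
      rw [abs_mul, abs_of_nonneg (by linarith : 0 ≤ 2 - b - T y)]
      exact mul_le_mul (hL y hy') (by linarith) (by linarith) ((abs_nonneg _).trans (hL y hy'))
    have b2 := hq y hy'
    have b3 : 0 ≤ 2 * (1 - y ^ 2) := by nlinarith [hy.1, hy.2, hxJ.2]
    refine (abs_sub _ _).trans ?_
    rw [abs_of_nonneg b3]
    have := abs_add_le ((T y - b) * (2 - b - T y)) (q y - b ^ 2)
    linarith
  rw [intervalIntegral.integral_const_mul, hWe, Real.norm_eq_abs] at e2
  rw [e1, abs_mul, abs_of_pos (by positivity)]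
  calc _ ≤ (1 - x) / (1 + x) * ((L * (2 - b) + ε) * ((1 + x) / (1 - x) / 2)) := by gcongr
    _ = _ := by field_simp

lemma r_main (q : ℝ → ℝ) (hqc : ContinuousOn q (Icc (-1 : ℝ) 0))
    (b c d : ℝ) (hb0 : 0 < b) (hb1 : b ≤ 1) (hb : b ^ 2 = q (-1))
    (hc : 0 < c) (hcd : c ≤ d) (hd : d < 1)
    (hbound : ∀ x ∈ Icc (-1 : ℝ) 0, c ^ 2 ≤ q x ∧ q x ≤ d ^ 2) :
    ∃ T : ℝ → ℝ, ContinuousOn T rJ ∧ Tendsto T (𝓝[>] (-1)) (𝓝 b) ∧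
      (∀ x ∈ Ioo (-1 : ℝ) 0, HasDerivAt T ((- T x ^ 2 - 2 * (1 - x ^ 2) + q x) / (1 - x ^ 2)) x) ∧
      (∀ x ∈ rJ, rE c x ≤ T x ∧ T x ≤ rE d x) := by
  have hd0 : 0 < d := hc.trans_le hcd
  have hqJ : ContinuousOn q rJ := hqc.mono Ioc_subset_Icc_self
  have hqm : AEStronglyMeasurable q (volume.restrict rJ) :=
    hqJ.aestronglyMeasurable measurableSet_Ioc
  have hq1 : ∀ y ∈ rJ, |q y| ≤ 1 := by
    intro y hy
    have := hbound y (Ioc_subset_Icc_self hy)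
    rw [abs_le]; constructor <;> nlinarith
  set M : ℝ := 1 / c + 1 with hM
  have hcp : 0 < 1 / c := by positivity
  have hTM : ∀ t y, y ∈ rJ → rE c y ≤ t → t ≤ rE d y → |t| ≤ M := by
    intro t y hy h1 h2
    have := rE_ge hc hy
    have := rE_le hd0 hy
    rw [abs_le]; constructor <;> linarith
  have hEm : ∀ e, 0 < e → AEStronglyMeasurable (rE e) (volume.restrict rJ) := fun e he =>
    ((rE_cont he).mono Ioc_subset_Icc_self).aestronglyMeasurable measurableSet_Ioc
  have hEM : ∀ e, c ≤ e → e ≤ d → ∀ y ∈ rJ, |rE e y| ≤ M := fun e h1 h2 y hy =>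
    hTM _ y hy (rE_mono hc h1 hy) (rE_mono (hc.trans_le h1) h2 hy)
  have hEi : ∀ e, c ≤ e → e ≤ d → IntegrableOn (rF (fun _ => e ^ 2) (rE e)) rJ := fun e h1 h2 =>
    rF_int (M := M) aestronglyMeasurable_const (hEm e (hc.trans_le h1)) (hEM e h1 h2) (by
      intro y hy
      rw [abs_le]; constructor <;> nlinarith)
  have hInteg : ∀ T : ℝ → ℝ, AEStronglyMeasurable T (volume.restrict rJ) →
      (∀ y ∈ rJ, rE c y ≤ T y ∧ T y ≤ rE d y) → IntegrableOn (rF q T) rJ := fun T h1 h2 =>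
    rF_int hqm h1 (fun y hy => hTM _ y hy (h2 y hy).1 (h2 y hy).2) hq1
  have hd1 : ∀ y ∈ rJ, rE d y ≤ 1 := fun y hy => (rE_le hd0 hy).trans hd.le
  set S := rSeq q c with hS
  have hP : ∀ n, AEStronglyMeasurable (S n) (volume.restrict rJ) ∧
      ∀ y ∈ rJ, rE c y ≤ S n y ∧ S n y ≤ rE d y := by
    intro n
    induction n with
    | zero => exact ⟨hEm c hc, fun y hy => ⟨le_rfl, rE_mono hc hcd hy⟩⟩
    | succ n ih =>
      have hi := hInteg _ ih.1 ih.2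
      refine ⟨(rPhi_cont hi).aestronglyMeasurable measurableSet_Ioc, fun y hy => ⟨?_, ?_⟩⟩
      · rw [← rE_fix hc (hEi c le_rfl hcd) hy]
        exact rPhi_mono (hEi c le_rfl hcd) hi (fun y hy => (ih.2 y hy).1)
          (fun y hy => (ih.2 y hy).2.trans (hd1 y hy))
          (fun y hy => (hbound y (Ioc_subset_Icc_self hy)).1) hy
      · rw [← rE_fix hd0 (hEi d hcd le_rfl) hy]
        exact rPhi_mono hi (hEi d hcd le_rfl) (fun y hy => (ih.2 y hy).2)
          hd1 (fun y hy => (hbound y (Ioc_subset_Icc_self hy)).2) hy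
  have hstep : ∀ n, ∀ y ∈ rJ, S n y ≤ S (n + 1) y := by
    intro n
    induction n with
    | zero => intro y hy; exact ((hP 1).2 y hy).1
    | succ n ih =>
      intro y hy
      exact rPhi_mono (hInteg _ (hP n).1 (hP n).2) (hInteg _ (hP (n+1)).1 (hP (n+1)).2) ih
        (fun y hy => ((hP (n+1)).2 y hy).2.trans (hd1 y hy)) (fun _ _ => le_rfl) hy
  set T : ℝ → ℝ := fun x => ⨆ n, S n x with hT
  have hlim : ∀ y ∈ rJ, Tendsto (fun n => S n y) atTop (𝓝 (T y)) := by
    intro y hy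
    refine tendsto_atTop_ciSup (monotone_nat_of_le_succ fun n => hstep n y hy) ⟨rE d y, ?_⟩
    rintro _ ⟨n, rfl⟩
    exact ((hP n).2 y hy).2
  have hTb : ∀ y ∈ rJ, rE c y ≤ T y ∧ T y ≤ rE d y := fun y hy =>
    ⟨ge_of_tendsto' (hlim y hy) fun n => ((hP n).2 y hy).1,
      le_of_tendsto' (hlim y hy) fun n => ((hP n).2 y hy).2⟩
  have hTm : AEStronglyMeasurable T (volume.restrict rJ) := by
    refine aestronglyMeasurable_of_tendsto_ae atTop (fun n => (hP n).1) ?_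
    filter_upwards [ae_restrict_mem measurableSet_Ioc] with y hy
    exact hlim y hy
  have hTi := hInteg T hTm hTb
  have hfix : ∀ x ∈ rJ, T x = rPhi q T x := by
    intro x hx
    refine tendsto_nhds_unique ((tendsto_add_atTop_iff_nat 1).2 (hlim x hx)) ?_
    change Tendsto (fun n => (1 - x) / (1 + x) * ∫ y in (-1 : ℝ)..x, rF q (S n) y) atTop
      (𝓝 ((1 - x) / (1 + x) * ∫ y in (-1 : ℝ)..x, rF q T y))
    refine Tendsto.const_mul _ ?_
    have hsub : uIoc (-1) x ⊆ rJ := by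
      rw [uIoc_of_le hx.1.le]; exact Ioc_subset_Ioc_right hx.2
    refine intervalIntegral.tendsto_integral_filter_of_dominated_convergence
      (fun _ => 2 * M + M ^ 2 + 3) ?_ ?_ ?_ ?_
    · refine Eventually.of_forall fun n => ?_
      exact (rF_meas hqm (hP n).1).mono_measure (Measure.restrict_mono hsub le_rfl)
    · refine Eventually.of_forall fun n => Eventually.of_forall fun y hy => ?_
      exact rF_bound (hsub hy) (hTM _ y (hsub hy) ((hP n).2 y (hsub hy)).1 ((hP n).2 y (hsub hy)).2)
        (hq1 y (hsub hy))
    · exact intervalIntegrable_const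
    · refine Eventually.of_forall fun y hy => ?_
      have := hlim y (hsub hy)
      unfold rF
      exact ((((this.const_mul 2).sub (this.pow 2)).add_const _).div_const _).sub_const _
  have hTc : ContinuousOn T rJ := (rPhi_cont hTi).congr hfix
  refine ⟨T, hTc, ?_, ?_, hTb⟩
  · rw [Metric.tendsto_nhdsWithin_nhds]
    intro ε hε
    -- choose a neighbourhood
    set η := ε * b / 2 with hη
    have hη0 : 0 < η := by positivity
    have g1 : ContinuousWithinAt (fun y => |q y - b ^ 2| + 2 * (1 - y ^ 2)) (Icc (-1) 0) (-1) := by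
      have := hqc (-1) (by simp)
      refine ContinuousWithinAt.add (this.sub continuousWithinAt_const).abs (by fun_prop)
    have g2 : ContinuousWithinAt (rE c) (Icc (-1) 0) (-1) := rE_cont hc (-1) (by simp)
    have g3 : ∀ᶠ y in 𝓝[Icc (-1) 0] (-1 : ℝ), |q y - b ^ 2| + 2 * (1 - y ^ 2) < η :=
      g1.eventually_lt continuousWithinAt_const (by simp [hb, hη0])
    have g4 : ∀ᶠ y in 𝓝[Icc (-1) 0] (-1 : ℝ), 0 < rE c y :=
      continuousWithinAt_const.eventually_lt g2 (by simp [rE, hc])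
    obtain ⟨δ, hδ, hδ'⟩ := Metric.mem_nhdsWithin_iff.1 (g3.and g4)
    set x0 : ℝ := min 0 (-1 + δ / 2) with hx0
    have hx0J : x0 ∈ rJ := ⟨by rw [hx0, lt_min_iff]; constructor <;> linarith, min_le_left _ _⟩
    have hsub : Ioc (-1) x0 ⊆ rJ := Ioc_subset_Ioc_right hx0J.2
    have hg : ∀ y ∈ Ioc (-1) x0, |q y - b ^ 2| + 2 * (1 - y ^ 2) < η ∧ 0 < rE c y := by
      intro y hy
      refine hδ' ⟨?_, Ioc_subset_Icc_self (hsub hy)⟩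
      rw [Metric.mem_ball, Real.dist_eq, abs_of_pos (by linarith [hy.1])]
      have : y ≤ -1 + δ / 2 := hy.2.trans (min_le_right _ _)
      linarith
    set L := sSup ((fun y => |T y - b|) '' Ioc (-1) x0) with hL
    have hbdd : BddAbove ((fun y => |T y - b|) '' Ioc (-1) x0) := by
      refine ⟨M + b, ?_⟩
      rintro _ ⟨y, hy, rfl⟩
      have := hTM _ y (hsub hy) (hTb y (hsub hy)).1 (hTb y (hsub hy)).2
      refine (abs_sub _ _).trans ?_
      rw [abs_of_pos hb0]; linarith
    have hLle : ∀ y ∈ Ioc (-1) x0, |T y - b| ≤ L := fun y hy => le_csSup hbdd ⟨y, hy, rfl⟩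
    have hloc := r_local hb0 hb1 hTi hx0J hfix
      (fun y hy => ⟨(hg y hy).2.le.trans (hTb y (hsub hy)).1,
        (hTb y (hsub hy)).2.trans (hd1 y (hsub hy))⟩) (fun y hy => (hg y hy).1.le) hLle
    have hL2 : L ≤ (L * (2 - b) + η) / 2 := by
      refine csSup_le ⟨_, ⟨x0, ⟨hx0J.1, le_rfl⟩, rfl⟩⟩ ?_
      rintro _ ⟨y, hy, rfl⟩
      exact hloc y hy
    have hLε : L < ε := by
      have : L * b ≤ ε * b / 2 := by linarith
      have h3 : L * b < ε * b := by nlinarith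
      exact lt_of_mul_lt_mul_right h3 hb0.le
    refine ⟨x0 + 1, by linarith [hx0J.1], ?_⟩
    intro x hx hxd
    have hx' : -1 < x := hx
    rw [Real.dist_eq, abs_of_pos (by linarith)] at hxd
    rw [Real.dist_eq]
    exact (hLle x ⟨hx', by linarith⟩).trans_lt hLε
  · intro x hx
    have hxJ : x ∈ rJ := Ioo_subset_Ioc_self hx
    have p1 : 0 < 1 - x := by linarith [hx.2]
    have p2 : 0 < 1 + x := by linarith [hx.1]
    have hFc : ContinuousOn (rF q T) (Ioo (-1) 0) := by
      have hT' := hTc.mono Ioo_subset_Ioc_self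
      have hq' := hqJ.mono Ioo_subset_Ioc_self
      unfold rF
      refine ContinuousOn.sub (ContinuousOn.div (by fun_prop) (by fun_prop) ?_)
        (ContinuousOn.div (by fun_prop) (by fun_prop) ?_)
      · intro y hy
        have : 0 < 1 - y := by linarith [hy.2]
        positivity
      · intro y hy
        have : 0 < 1 - y := by linarith [hy.2]
        positivity
    have hI : HasDerivAt (fun x => ∫ y in (-1 : ℝ)..x, rF q T y) (rF q T x) x :=
      intervalIntegral.integral_hasDerivAt_right (rInt_sub hTi hxJ)
        (hFc.stronglyMeasurableAtFilter isOpen_Ioo x hx)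
        (hFc.continuousAt (isOpen_Ioo.mem_nhds hx))
    have hW := (((hasDerivAt_id x).const_sub 1).div ((hasDerivAt_id x).const_add 1) p2.ne').mul hI
    have heq : T =ᶠ[𝓝 x] fun x => (1 - x) / (1 + x) * ∫ y in (-1 : ℝ)..x, rF q T y := by
      filter_upwards [isOpen_Ioo.mem_nhds hx] with y hy
      exact hfix y (Ioo_subset_Ioc_self hy)
    refine (HasDerivAt.congr_of_eventuallyEq hW heq).congr_deriv ?_
    have hx3 := hfix x hxJ
    unfold rPhi at hx3
    set I := ∫ y in (-1 : ℝ)..x, rF q T y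
    have hI2 : I = (1 + x) / (1 - x) * T x := by rw [hx3]; field_simp
    simp only [id, Pi.div_apply, Pi.sub_apply]
    rw [hI2]
    unfold rF
    have p3 : 1 - x ^ 2 ≠ 0 := by
      have : 0 < (1 - x) * (1 + x) := by positivity
      nlinarith
    rw [show 1 - x ^ 2 = (1 - x) * (1 + x) by ring]
    field_simp
    ring

end


theorem stmt_11 (f : ℝ → ℝ) (hfc : ContinuousOn f (Set.Icc (-1 : ℝ) 0))
    (hf : ∀ x ∈ Set.Icc (-1 : ℝ) 0, 0 < f x ∧ f x < 1 / 2)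
    (b : ℝ) (hb : b = Real.sqrt (1 - 2 * f (-1)))
    (c d : ℝ) (hc : 0 < c) (hcd : c ≤ d) (hd : d < 1)
    (hbound : ∀ x ∈ Set.Icc (-1 : ℝ) 0, c ^ 2 ≤ 1 - 2 * f x ∧ 1 - 2 * f x ≤ d ^ 2)
    (Tc Td : ℝ → ℝ)
    (hTc : ∀ x, Tc x = c - (1 - x ^ 2) / (c - x))
    (hTd : ∀ x, Td x = d - (1 - x ^ 2) / (d - x)) :
    ∃ T : ℝ → ℝ, ContinuousOn T (Set.Icc (-1 : ℝ) 0) ∧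
      DifferentiableOn ℝ T (Set.Ioo (-1 : ℝ) 0) ∧
      T (-1) = b ∧
      (∀ x ∈ Set.Ioo (-1 : ℝ) 0,
        (1 - x ^ 2) * deriv T x + T x ^ 2 = -2 * (1 - x ^ 2) + (1 - 2 * f x)) ∧
      (∀ x ∈ Set.Icc (-1 : ℝ) 0, Tc x ≤ T x ∧ T x ≤ Td x) ∧
      T 0 ≤ d - 1 / d ∧ d - 1 / d < 0 := by
  have hd0 : 0 < d := hc.trans_le hcd
  have hb' := hbound (-1) (by simp)
  have hbsq : b ^ 2 = 1 - 2 * f (-1) := by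
    rw [hb, Real.sq_sqrt]; nlinarith
  have hbn : 0 ≤ b := hb ▸ Real.sqrt_nonneg _
  have hcb : c ≤ b := by nlinarith
  have hbd : b ≤ d := by nlinarith
  obtain ⟨T, hTc', hTl, hTd', hTb⟩ := r_main (fun x => 1 - 2 * f x) (by fun_prop) b c d
    (hc.trans_le hcb) (hbd.trans hd.le) hbsq hc hcd hd hbound
  have hne : ∀ x : ℝ, -1 < x → Function.update T (-1) b x = T x := fun x hx =>
    Function.update_of_ne hx.ne' _ _
  have hder : ∀ x ∈ Set.Ioo (-1 : ℝ) 0, HasDerivAt (Function.update T (-1) b)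
      ((- T x ^ 2 - 2 * (1 - x ^ 2) + (1 - 2 * f x)) / (1 - x ^ 2)) x := by
    intro x hx
    refine (hTd' x hx).congr_of_eventuallyEq ?_
    filter_upwards [isOpen_Ioo.mem_nhds hx] with y hy
    exact hne y hy.1
  have hfin : ∀ x ∈ Set.Icc (-1 : ℝ) 0, Tc x ≤ Function.update T (-1) b x ∧
      Function.update T (-1) b x ≤ Td x := by
    intro x hx
    rcases hx.1.eq_or_lt with h | h
    · subst h
      rw [hTc, hTd]
      simp [hcb, hbd]
    · rw [hne x h, hTc, hTd]
      exact hTb x ⟨h, hx.2⟩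
  refine ⟨Function.update T (-1) b, ?_, fun x hx => (hder x hx).differentiableAt.differentiableWithinAt,
    by simp, ?_, hfin, ?_, ?_⟩
  · rw [continuousOn_update_iff]
    have hs : Set.Icc (-1 : ℝ) 0 \ {-1} = Set.Ioc (-1) 0 := Set.Icc_diff_left
    rw [hs]
    exact ⟨hTc', fun _ => hTl.mono_left (nhdsWithin_mono _ fun x hx => hx.1)⟩
  · intro x hx
    rw [(hder x hx).deriv, hne x hx.1]
    have p3 : 1 - x ^ 2 ≠ 0 := by
      have : 0 < (1 - x) * (1 + x) := mul_pos (by linarith [hx.2]) (by linarith [hx.1])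
      nlinarith
    field_simp
    ring
  · have := (hfin 0 (by simp)).2
    rw [hTd] at this
    simpa using this
  · have : 1 < 1 / d := by rw [lt_div_iff₀ hd0]; linarith
    linarith
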